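/- Let ⋆ be a semistar operation on an integral domain D. If D is ⋆̃-Noetherian, i.e., D satisfies the ascending chain condition on quasi-⋆̃-ideals, then D is a ⋆̃-stably strong S-domain. -/

import Mathlib

/- ## Preliminaries: general ideal-chain notions in a commutative ring -/

open Pointwise

section ChainNotions

variable {A B : Type*} [CommRing A] [CommRing B]

/-- `P` and `Q` are adjacent with respect to the class `Φ` of ideals:
`P ⊂ Q` and no ideal of the class `Φ` lies strictly between them. -/
def AdjacentFor (Φ : Ideal A → Prop) (P Q : Ideal A) : Prop :=
  P < Q ∧ ∀ I : Ideal A, Φ I → ¬(P < I ∧ I < Q)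

/-- A saturated chain, consisting of ideals of the class `Φ`, of length `m`
between `P` and `Q` (saturated: consecutive members are `Φ`-adjacent). -/
def SaturatedChainFor (Φ : Ideal A → Prop) (P Q : Ideal A) (m : ℕ) : Prop :=
  ∃ c : Fin (m + 1) → Ideal A, StrictMono c ∧ c 0 = P ∧ c (Fin.last m) = Q ∧
    (∀ i, Φ (c i)) ∧ ∀ i : Fin m, AdjacentFor Φ (c i.castSucc) (c i.succ)

/-- Catenarity with respect to the class `Φ` of ideals: for every pair `P ⊂ Q` of
`Φ`-ideals, any two saturated chains of `Φ`-ideals between `P` and `Q` have the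
same (finite) length. -/
def CatenaryFor (Φ : Ideal A → Prop) : Prop :=
  ∀ P Q : Ideal A, Φ P → Φ Q → P < Q →
    ∀ m₁ m₂ : ℕ, SaturatedChainFor Φ P Q m₁ → SaturatedChainFor Φ P Q m₂ → m₁ = m₂

/-- A chain `(0) = P₀ ⊂ P₁ ⊂ ⋯ ⊂ Pₙ` with all `Pᵢ`, `1 ≤ i ≤ n`, in the class `Φ`. -/
def DimChainFor (Φ : Ideal A → Prop) (n : ℕ) : Prop :=
  ∃ c : Fin (n + 1) → Ideal A, StrictMono c ∧ c 0 = ⊥ ∧ ∀ i, i ≠ 0 → Φ (c i)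

/-- The dimension associated to the class `Φ` of (quasi-prime) ideals: the supremum of
the lengths of chains `(0) = P₀ ⊂ P₁ ⊂ ⋯ ⊂ Pₙ` with all `Pᵢ` (`i ≥ 1`) in `Φ`. -/
noncomputable def quasiDim (Φ : Ideal A → Prop) : ℕ∞ :=
  ⨆ (n : ℕ) (_ : DimChainFor Φ n), (n : ℕ∞)

/-- The height of an ideal `P`: the supremum of lengths of strict chains of prime
ideals ending at `P`. -/
noncomputable def idealHeight (P : Ideal A) : ℕ∞ :=
  ⨆ (n : ℕ) (_ : ∃ c : Fin (n + 1) → Ideal A, StrictMono c ∧ (∀ i, (c i).IsPrime) ∧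
      c (Fin.last n) = P), (n : ℕ∞)

/-- The Krull dimension of a commutative ring, as the supremum in `ℕ∞` of the lengths
of strict chains of prime ideals. -/
noncomputable def krullDimE (A : Type*) [CommRing A] : ℕ∞ :=
  ⨆ (n : ℕ) (_ : ∃ c : Fin (n + 1) → Ideal A, StrictMono c ∧ ∀ i, (c i).IsPrime), (n : ℕ∞)

/-- Every pair of `Φ`-adjacent `Φ`-ideals `P ⊂ Q` of `A` extends, along `f : A →+* B`,
to a pair of `Ψ`-adjacent `Ψ`-ideals `P.map f ⊂ Q.map f` of `B`. -/
def ExtendsAdjacent (f : A →+* B) (Φ : Ideal A → Prop) (Ψ : Ideal B → Prop) : Prop :=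
  ∀ P Q : Ideal A, Φ P → Φ Q → AdjacentFor Φ P Q →
    Ψ (Ideal.map f P) ∧ Ψ (Ideal.map f Q) ∧ AdjacentFor Ψ (Ideal.map f P) (Ideal.map f Q)

/-- A (classically) catenary ring: any two saturated chains of primes between a fixed
pair of primes `P ⊂ Q` have the same finite length. -/
def IsCatenaryRing (A : Type*) [CommRing A] : Prop :=
  CatenaryFor (fun I : Ideal A => I.IsPrime)

/-- A (classical) S-domain: every height-one prime `P` extends to a height-one prime
`P[X]` of the polynomial ring. -/
def IsSDomain (A : Type*) [CommRing A] : Prop :=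
  ∀ P : Ideal A, P.IsPrime → idealHeight P = 1 →
    idealHeight (Ideal.map (Polynomial.C : A →+* Polynomial A) P) = 1

/-- A (classical) strong S-domain: every pair of adjacent primes `P ⊂ Q` extends to a
pair of adjacent primes `P[X] ⊂ Q[X]` of the polynomial ring. -/
def IsStrongSDomain (A : Type*) [CommRing A] : Prop :=
  ExtendsAdjacent (Polynomial.C : A →+* Polynomial A)
    (fun I : Ideal A => I.IsPrime) (fun I : Ideal (Polynomial A) => I.IsPrime)

/-- A (classical) stably strong S-domain: `A[X₁,…,Xₙ]` is a strong S-domain for all `n ≥ 1`. -/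
def IsStablyStrongSDomain (A : Type*) [CommRing A] : Prop :=
  ∀ n : ℕ, 1 ≤ n → IsStrongSDomain (MvPolynomial (Fin n) A)

/-- A (classical) Jaffard domain: finite Krull dimension, and
`dim (A[X₁,…,Xₙ]) = dim A + n` for all `n ≥ 1`. -/
def IsJaffardDomain (A : Type*) [CommRing A] : Prop :=
  krullDimE A ≠ ⊤ ∧ ∀ n : ℕ, 1 ≤ n → krullDimE (MvPolynomial (Fin n) A) = krullDimE A + n

end ChainNotions

/- ## Semistar operations -/

section Semistar

variable (R : Type*) (F : Type*) [CommRing R] [Field F] [Algebra R F]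

instance (priority := 100) : SMulCommClass F R F := SMulCommClass.symm R F F

/-- A semistar operation on a domain `R` with quotient field `F`: an operation on the
(nonzero) `R`-submodules of `F` satisfying `(xE)^⋆ = x E^⋆`, monotonicity, extensivity
and idempotency. (The value on the zero submodule is irrelevant.) -/
structure SemistarOp where
  /-- the underlying map on `R`-submodules of `F` -/
  star : Submodule R F → Submodule R F
  star_smul : ∀ x : F, x ≠ 0 → ∀ E : Submodule R F, E ≠ ⊥ → star (x • E) = x • star E
  star_mono : ∀ E G : Submodule R F, E ≠ ⊥ → G ≠ ⊥ → E ≤ G → star E ≤ star G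
  le_star : ∀ E : Submodule R F, E ≠ ⊥ → E ≤ star E
  star_idem : ∀ E : Submodule R F, E ≠ ⊥ → star (star E) = star E

variable {R F}

/-- The extension of an ideal of `R` to an `R`-submodule of `F`. -/
def idealExt (I : Ideal R) : Submodule R F := Submodule.map (Algebra.linearMap R F) I

/-- The contraction to `R` of an `R`-submodule of `F` (i.e. `E ∩ R`). -/
def idealCon (E : Submodule R F) : Ideal R := Submodule.comap (Algebra.linearMap R F) E

/-- The finite-type semistar operation `⋆_f` associated to `⋆`:
`E^{⋆_f}` is the union of `G^⋆` over all nonzero finitely generated `G ⊆ E`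
(the family is directed, so the union is the supremum). -/
noncomputable def SemistarOp.ft (s : SemistarOp R F) (E : Submodule R F) : Submodule R F :=
  ⨆ (G : Submodule R F) (_ : G.FG ∧ G ≠ ⊥ ∧ G ≤ E), s.star G

/-- `I` is a quasi-`f`-ideal (for `f` a semistar-type operation, e.g. `s.star`, `s.ft`
or `s.tilde`): `I` is nonzero and `f(I) ∩ R = I`. -/
def IsQuasiIdeal (f : Submodule R F → Submodule R F) (I : Ideal R) : Prop :=
  I ≠ ⊥ ∧ idealCon (f (idealExt I)) = I

/-- A quasi-prime: a prime quasi-ideal. -/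
def IsQuasiPrime (f : Submodule R F → Submodule R F) (I : Ideal R) : Prop :=
  I.IsPrime ∧ IsQuasiIdeal f I

/-- A quasi-maximal ideal: maximal among proper quasi-ideals. -/
def IsQuasiMax (f : Submodule R F → Submodule R F) (I : Ideal R) : Prop :=
  IsQuasiIdeal f I ∧ I ≠ ⊤ ∧ ∀ J : Ideal R, IsQuasiIdeal f J → J ≠ ⊤ → I ≤ J → I = J

/-- The stable finite-type semistar operation `⋆̃` associated to `⋆`:
`E^{⋆̃} = ⋂ { E R_P : P a quasi-⋆_f-maximal ideal }`, where
`x ∈ E R_P ↔ ∃ d ∉ P, d • x ∈ E` (each quasi-⋆_f-maximal ideal is prime); if there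
is no quasi-⋆_f-maximal ideal, `E^{⋆̃} = F`. -/
def SemistarOp.tilde (s : SemistarOp R F) (E : Submodule R F) : Submodule R F where
  carrier := {x : F | ∀ P : Ideal R, IsQuasiMax s.ft P → P.IsPrime →
    ∃ d : R, d ∉ P ∧ d • x ∈ E}
  zero_mem' := by
    intro P _ hP
    exact ⟨1, fun h => hP.ne_top ((Ideal.eq_top_iff_one P).mpr h), by simp⟩
  add_mem' := by
    intro x y hx hy P hPmax hP
    obtain ⟨d₁, hd₁, hdx⟩ := hx P hPmax hP
    obtain ⟨d₂, hd₂, hdy⟩ := hy P hPmax hP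
    refine ⟨d₁ * d₂, fun h => (hP.mem_or_mem h).elim hd₁ hd₂, ?_⟩
    have h₁ : (d₁ * d₂) • x ∈ E := by rw [mul_comm, mul_smul]; exact E.smul_mem d₂ hdx
    have h₂ : (d₁ * d₂) • y ∈ E := by rw [mul_smul]; exact E.smul_mem d₁ hdy
    simpa [smul_add] using E.add_mem h₁ h₂
  smul_mem' := by
    intro r x hx P hPmax hP
    obtain ⟨d, hd, hdx⟩ := hx P hPmax hP
    refine ⟨d, hd, ?_⟩
    rw [smul_smul, mul_comm, ← smul_smul]
    exact E.smul_mem r hdx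

/-- The characterization of the quasi-`⋆[n]`-prime ideals of `R[n] = R[X₁,…,Xₙ]` for the
iterated Nagata-type (stable, finite-type) semistar operation `⋆[n]` on `R[n]`:
a nonzero prime `Q` of `R[n]` is quasi-`⋆[n]`-prime iff `Q ∩ R = 0` or
`(Q ∩ R)^{⋆_f} ≠ R^⋆`. -/
def QuasiPolyPrime (s : SemistarOp R F) (n : ℕ) (Q : Ideal (MvPolynomial (Fin n) R)) : Prop :=
  Q ≠ ⊥ ∧ Q.IsPrime ∧
    (Ideal.comap (algebraMap R (MvPolynomial (Fin n) R)) Q = ⊥ ∨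
      s.ft (idealExt (Ideal.comap (algebraMap R (MvPolynomial (Fin n) R)) Q)) ≠
        s.star (idealExt (⊤ : Ideal R)))

/-- The `⋆̃`-dimension of `R`. -/
noncomputable def tildeDim (s : SemistarOp R F) : ℕ∞ := quasiDim (IsQuasiPrime s.tilde)

/-- The `⋆[n]`-dimension of `R[n] = R[X₁,…,Xₙ]`. -/
noncomputable def polyDim (s : SemistarOp R F) (n : ℕ) : ℕ∞ := quasiDim (QuasiPolyPrime s n)

/-- `R` is a `⋆̃`-S-domain: every height-one quasi-`⋆̃`-prime `P` extends to a height-one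
quasi-`⋆[1]`-prime `P[X₁]` of `R[X₁]`. -/
def TildeSDomain (s : SemistarOp R F) : Prop :=
  ∀ P : Ideal R, IsQuasiPrime s.tilde P → idealHeight P = 1 →
    QuasiPolyPrime s 1 (Ideal.map (algebraMap R (MvPolynomial (Fin 1) R)) P) ∧
    idealHeight (Ideal.map (algebraMap R (MvPolynomial (Fin 1) R)) P) = 1

/-- `R` is a `⋆̃`-strong S-domain: each pair of adjacent quasi-`⋆̃`-primes `P₁ ⊂ P₂`
extends to a pair of adjacent quasi-`⋆[1]`-primes `P₁[X₁] ⊂ P₂[X₁]` of `R[X₁]`. -/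
def TildeStrongSDomain (s : SemistarOp R F) : Prop :=
  ExtendsAdjacent (algebraMap R (MvPolynomial (Fin 1) R))
    (IsQuasiPrime s.tilde) (QuasiPolyPrime s 1)

/-- `R[n]` is a `⋆[n]`-strong S-domain: each pair of adjacent quasi-`⋆[n]`-primes
`Q₁ ⊂ Q₂` of `R[n]` extends to a pair of adjacent quasi-`⋆[n+1]`-primes
`Q₁[X_{n+1}] ⊂ Q₂[X_{n+1}]` of `R[n+1]`. -/
def PolyStrongSDomain (s : SemistarOp R F) (n : ℕ) : Prop :=
  ExtendsAdjacent (MvPolynomial.rename (Fin.castSucc : Fin n → Fin (n + 1))).toRingHom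
    (QuasiPolyPrime s n) (QuasiPolyPrime s (n + 1))

/-- `R` is a `⋆̃`-stably strong S-domain: `R[n]` is a `⋆[n]`-strong S-domain for all
`n ≥ 1`. -/
def TildeStablyStrongSDomain (s : SemistarOp R F) : Prop :=
  ∀ n : ℕ, 1 ≤ n → PolyStrongSDomain s n

/-- `R` is `⋆̃`-catenary. -/
def TildeCatenary (s : SemistarOp R F) : Prop := CatenaryFor (IsQuasiPrime s.tilde)

/-- `R[n]` is `⋆[n]`-catenary. -/
def PolyCatenary (s : SemistarOp R F) (n : ℕ) : Prop := CatenaryFor (QuasiPolyPrime s n)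

/-- `R` is `⋆̃`-universally catenarian: `R[n]` is `⋆[n]`-catenary for all `n ≥ 1`. -/
def TildeUnivCatenarian (s : SemistarOp R F) : Prop :=
  ∀ n : ℕ, 1 ≤ n → PolyCatenary s n

/-- `R` is a `⋆̃`-Jaffard domain. -/
def TildeJaffard (s : SemistarOp R F) : Prop :=
  tildeDim s ≠ ⊤ ∧ ∀ n : ℕ, 1 ≤ n → polyDim s n = tildeDim s + n

/-- `R` is `⋆̃`-Noetherian: ascending chain condition on quasi-`⋆̃`-ideals. -/
def TildeNoetherian (s : SemistarOp R F) : Prop :=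
  ∀ f : ℕ → Ideal R, (∀ i, IsQuasiIdeal s.tilde (f i)) → Monotone f →
    ∃ N : ℕ, ∀ m : ℕ, N ≤ m → f m = f N

/-- `R` is a `⋆̃`-quasi-Prüfer domain: every prime `Q` of `R[X]` with `Q ⊆ P[X]` for some
quasi-`⋆̃`-prime `P` of `R` satisfies `Q = (Q ∩ R)[X]`. -/
def TildeQuasiPrufer (s : SemistarOp R F) : Prop :=
  ∀ Q : Ideal (Polynomial R), Q.IsPrime →
    (∃ P : Ideal R, IsQuasiPrime s.tilde P ∧
      Q ≤ Ideal.map (Polynomial.C : R →+* Polynomial R) P) →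
    Q = Ideal.map (Polynomial.C : R →+* Polynomial R)
      (Ideal.comap (Polynomial.C : R →+* Polynomial R) Q)

/-- `R` is a Prüfer `⋆`-multiplication domain: `(I · (R :_F I))^{⋆_f} = R^⋆` for every
nonzero finitely generated ideal `I` of `R`. -/
def IsPStarMD (s : SemistarOp R F) : Prop :=
  ∀ I : Ideal R, I ≠ ⊥ → I.FG →
    s.ft (idealExt I * ((idealExt (⊤ : Ideal R) : Submodule R F) / idealExt I)) =
      s.star (idealExt (⊤ : Ideal R))

/-- An overring `T` of `R` (with semistar operation `⋆'`) is `(⋆,⋆')`-linked to `R`: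
for every nonzero finitely generated ideal `G` of `R`, `G^⋆ = R^⋆` implies
`(GT)^{⋆'} = T^{⋆'}`. -/
def IsLinkedOverring (s : SemistarOp R F) (T : Subalgebra R F) (s' : SemistarOp T F) : Prop :=
  ∀ G : Ideal R, G ≠ ⊥ → G.FG →
    s.star (idealExt G) = s.star (idealExt (⊤ : Ideal R)) →
      s'.star (idealExt (Ideal.map (algebraMap R T) G)) =
        s'.star (idealExt (⊤ : Ideal T))

/-- `R` is a `⋆̃`-going-down domain: for every overring `T` of `R` (a subring of `F`
containing `R`; note `F` is also the quotient field of `T`) and every semistar operation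
`⋆'` on `T`, the extension `R ⊆ T` satisfies `(⋆̃,⋆̃')`-GD. -/
def TildeGoingDown (s : SemistarOp R F) : Prop :=
  ∀ (T : Subalgebra R F) (s' : SemistarOp T F),
    ∀ P₀ P : Ideal R, IsQuasiPrime s.tilde P₀ → IsQuasiPrime s.tilde P → P₀ < P →
      ∀ Q : Ideal T, IsQuasiPrime s'.tilde Q → Ideal.comap (algebraMap R T) Q = P →
        ∃ Q₀ : Ideal T, IsQuasiPrime s'.tilde Q₀ ∧ Q₀ ≤ Q ∧
          Ideal.comap (algebraMap R T) Q₀ = P₀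

end Semistar

section RelativeHeight

variable {A B : Type*} [CommRing A] [CommRing B]

/-- Krull's principal ideal theorem relative to a prime `p`: no prime lies strictly between `p`
and a minimal prime of `p + (x)`. -/
theorem Ideal.not_lt_lt_of_mem_minimalPrimes_sup_span [IsNoetherianRing A] {p i q : Ideal A} {x : A}
    (hp : p.IsPrime) (hi : i.IsPrime) (hq : q ∈ (p ⊔ Ideal.span {x}).minimalPrimes)
    (hpi : p < i) : ¬ i < q := by
  intro hiq
  have hqp : q.IsPrime := hq.isPrime
  have hmap : ∀ j : Ideal A, j.IsPrime → p ≤ j → (j.map (Ideal.Quotient.mk p)).IsPrime :=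
    fun j hj hpj => Ideal.map_isPrime_of_surjective Ideal.Quotient.mk_surjective
      (Ideal.mk_ker.trans_le hpj)
  have hcomap : ∀ j : Ideal A, p ≤ j →
      (j.map (Ideal.Quotient.mk p)).comap (Ideal.Quotient.mk p) = j := fun j hpj => by
    rw [Ideal.comap_map_of_surjective' _ Ideal.Quotient.mk_surjective, Ideal.mk_ker, sup_eq_left]
    exact hpj
  have hlt : ∀ j k : Ideal A, p ≤ j → j < k →
      j.map (Ideal.Quotient.mk p) < k.map (Ideal.Quotient.mk p) := fun j k hpj hjk => by
    refine lt_of_le_of_ne (Ideal.map_mono hjk.le) fun h => hjk.ne ?_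
    rw [← hcomap j hpj, h, hcomap k (hpj.trans hjk.le)]
  have := hmap p hp le_rfl
  have := hmap i hi hpi.le
  have := hmap q hqp (hpi.le.trans hiq.le)
  have h₁ := Ideal.height_add_one_le_of_lt_of_isPrime (hlt p i le_rfl hpi)
  have h₂ := Ideal.height_add_one_le_of_lt_of_isPrime (hlt i q hpi.le hiq)
  have h₃ := Ideal.map_height_le_one_of_mem_minimalPrimes hq
  have h₄ : (1 : ℕ∞) + 1 ≤ 1 := by
    refine le_trans ?_ (h₂.trans h₃)
    gcongr
    exact le_trans le_add_self h₁
  exact absurd h₄ (by decide)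

/-- If the prime `q` survives in a Noetherian localization and is the only prime between `p` and `q`
that contains `x`, then no prime lies strictly between `p` and `q`. -/
theorem Ideal.not_lt_lt_of_isLocalization [Algebra A B] (M : Submonoid A) [IsLocalization M B]
    [IsNoetherianRing B] {p i q : Ideal A} {x : A} (hp : p.IsPrime) (hi : i.IsPrime)
    (hq : q.IsPrime) (hd : Disjoint (M : Set A) q) (hxq : x ∈ q)
    (hmin : ∀ j : Ideal A, j.IsPrime → p ≤ j → x ∈ j → j ≤ q → j = q)
    (hpi : p < i) : ¬ i < q := by
  intro hiq
  have hdi : Disjoint (M : Set A) i := hd.mono_right hiq.le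
  have hdp : Disjoint (M : Set A) p := hdi.mono_right hpi.le
  have hunder : ∀ j : Ideal A, j.IsPrime → Disjoint (M : Set A) j →
      (j.map (algebraMap A B)).under A = j :=
    fun j hj hdj => IsLocalization.under_map_of_isPrime_disjoint M B hj hdj
  have hlt : ∀ j k : Ideal A, j.IsPrime → k.IsPrime → Disjoint (M : Set A) j →
      Disjoint (M : Set A) k → j < k → j.map (algebraMap A B) < k.map (algebraMap A B) :=
    fun j k hj hk hdj hdk hjk => by
      refine lt_of_le_of_ne (Ideal.map_mono hjk.le) fun h => hjk.ne ?_
      rw [← hunder j hj hdj, h, hunder k hk hdk]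
  refine Ideal.not_lt_lt_of_mem_minimalPrimes_sup_span (x := algebraMap A B x)
    (IsLocalization.isPrime_of_isPrime_disjoint M B p hp hdp)
    (IsLocalization.isPrime_of_isPrime_disjoint M B i hi hdi) ⟨⟨?_, ?_⟩, ?_⟩
    (hlt p i hp hi hdp hdi hpi) (hlt i q hi hq hdi hd hiq)
  · exact IsLocalization.isPrime_of_isPrime_disjoint M B q hq hd
  · rw [sup_le_iff, Ideal.span_singleton_le_iff_mem]
    exact ⟨Ideal.map_mono (hpi.le.trans hiq.le), Ideal.mem_map_of_mem _ hxq⟩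
  · rintro j ⟨hj, hpj⟩ hjq
    rw [sup_le_iff, Ideal.span_singleton_le_iff_mem, Ideal.map_le_iff_le_comap] at hpj
    have hjq' : j.under A ≤ q := by
      rw [← hunder q hq hd]
      exact Ideal.comap_mono hjq
    rw [← hmin (j.under A) (hj.comap _) hpj.1 hpj.2 hjq', IsLocalization.map_under M B]

end RelativeHeight

section LastVariable

variable {R : Type*} [CommRing R] {n : ℕ}

/-- `R[X₁,…,Xₙ₊₁]` as the polynomial ring over `R[X₁,…,Xₙ]` in the last variable. -/
noncomputable def MvPolynomial.lastVariableEquiv (R : Type*) [CommRing R] (n : ℕ) :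
    Polynomial (MvPolynomial (Fin n) R) ≃+* MvPolynomial (Fin (n + 1)) R :=
  ((MvPolynomial.optionEquivLeft R (Fin n)).symm.trans
    (MvPolynomial.renameEquiv R finSuccEquivLast.symm)).toRingEquiv

theorem MvPolynomial.lastVariableEquiv_comp_C :
    ((MvPolynomial.lastVariableEquiv R n).toRingHom).comp Polynomial.C =
      (MvPolynomial.rename (Fin.castSucc : Fin n → Fin (n + 1)) :
        MvPolynomial (Fin n) R →ₐ[R] _).toRingHom := by
  refine MvPolynomial.ringHom_ext (fun r => ?_) fun i => ?_ <;>
    simp [MvPolynomial.lastVariableEquiv]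

theorem MvPolynomial.map_rename_castSucc (Q : Ideal (MvPolynomial (Fin n) R)) :
    Q.map (MvPolynomial.rename (Fin.castSucc : Fin n → Fin (n + 1)) :
        MvPolynomial (Fin n) R →ₐ[R] _).toRingHom =
      (Q.map (Polynomial.C)).map (MvPolynomial.lastVariableEquiv R n) := by
  rw [← MvPolynomial.lastVariableEquiv_comp_C, ← Ideal.map_map]
  rfl

theorem MvPolynomial.isPrime_map_rename_castSucc {Q : Ideal (MvPolynomial (Fin n) R)}
    (hQ : Q.IsPrime) :
    (Q.map (MvPolynomial.rename (Fin.castSucc : Fin n → Fin (n + 1)) :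
        MvPolynomial (Fin n) R →ₐ[R] _).toRingHom).IsPrime := by
  rw [MvPolynomial.map_rename_castSucc]
  exact Ideal.map_isPrime_of_equiv _

theorem MvPolynomial.comap_map_rename_castSucc (Q : Ideal (MvPolynomial (Fin n) R)) :
    (Q.map (MvPolynomial.rename (Fin.castSucc : Fin n → Fin (n + 1)) :
        MvPolynomial (Fin n) R →ₐ[R] _).toRingHom).comap
      (MvPolynomial.rename (Fin.castSucc : Fin n → Fin (n + 1)) :
        MvPolynomial (Fin n) R →ₐ[R] _).toRingHom = Q := by
  rw [MvPolynomial.map_rename_castSucc, ← MvPolynomial.lastVariableEquiv_comp_C,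
    ← Ideal.comap_comap]
  have h : ((Q.map Polynomial.C).map (MvPolynomial.lastVariableEquiv R n)).comap
      (MvPolynomial.lastVariableEquiv R n).toRingHom = Q.map Polynomial.C :=
    Ideal.comap_map_of_bijective _ (MvPolynomial.lastVariableEquiv R n).bijective
  rw [h]
  refine le_antisymm (fun x hx => ?_) Ideal.le_comap_map
  simpa using Ideal.mem_map_C_iff.mp hx 0

theorem MvPolynomial.comap_algebraMap_comap_rename_castSucc
    (I : Ideal (MvPolynomial (Fin (n + 1)) R)) :
    (I.comap (MvPolynomial.rename (Fin.castSucc : Fin n → Fin (n + 1)) :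
        MvPolynomial (Fin n) R →ₐ[R] _).toRingHom).comap
      (algebraMap R (MvPolynomial (Fin n) R)) =
      I.comap (algebraMap R (MvPolynomial (Fin (n + 1)) R)) := by
  rw [Ideal.comap_comap]
  congr 1
  exact (MvPolynomial.rename (Fin.castSucc : Fin n → Fin (n + 1)) :
    MvPolynomial (Fin n) R →ₐ[R] _).comp_algebraMap

end LastVariable

section Semistar

variable {R F : Type*} [CommRing R] [Field F] [Algebra R F] (s : SemistarOp R F)

theorem SemistarOp.ft_mono {E E' : Submodule R F} (h : E ≤ E') : s.ft E ≤ s.ft E' :=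
  iSup₂_mono' fun G hG => ⟨G, ⟨hG.1, hG.2.1, hG.2.2.trans h⟩, le_rfl⟩

theorem SemistarOp.star_le_ft {E G : Submodule R F} (hG : G.FG) (h0 : G ≠ ⊥) (h : G ≤ E) :
    s.star G ≤ s.ft E :=
  le_iSup₂_of_le G ⟨hG, h0, h⟩ le_rfl

theorem SemistarOp.exists_fg_ne_bot_le {E : Submodule R F} (hE : E ≠ ⊥) :
    ∃ G : Submodule R F, G.FG ∧ G ≠ ⊥ ∧ G ≤ E := by
  obtain ⟨y, hy, hy0⟩ := Submodule.exists_mem_ne_zero_of_ne_bot hE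
  exact ⟨Submodule.span R {y}, Submodule.fg_span_singleton y,
    by simpa [Submodule.span_singleton_eq_bot] using hy0,
    (Submodule.span_singleton_le_iff_mem _ _).mpr hy⟩

theorem SemistarOp.mem_ft {E : Submodule R F} (hE : E ≠ ⊥) {x : F} :
    x ∈ s.ft E ↔ ∃ G : Submodule R F, G.FG ∧ G ≠ ⊥ ∧ G ≤ E ∧ x ∈ s.star G := by
  obtain ⟨G₀, hG₀⟩ := SemistarOp.exists_fg_ne_bot_le hE
  have : Nonempty {G : Submodule R F // G.FG ∧ G ≠ ⊥ ∧ G ≤ E} := ⟨⟨G₀, hG₀⟩⟩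
  have hdir : Directed (· ≤ ·)
      fun G : {G : Submodule R F // G.FG ∧ G ≠ ⊥ ∧ G ≤ E} => s.star G.1 := by
    rintro ⟨G, hG, hG0, hGE⟩ ⟨H, hH, hH0, hHE⟩
    have h0 : G ⊔ H ≠ ⊥ := ne_bot_of_le_ne_bot hG0 le_sup_left
    exact ⟨⟨G ⊔ H, hG.sup hH, h0, sup_le hGE hHE⟩, s.star_mono _ _ hG0 h0 le_sup_left,
      s.star_mono _ _ hH0 h0 le_sup_right⟩
  rw [SemistarOp.ft, iSup_subtype', Submodule.mem_iSup_of_directed _ hdir]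
  simp [and_assoc]

theorem SemistarOp.le_ft (E : Submodule R F) : E ≤ s.ft E := by
  intro x hx
  by_cases hx0 : x = 0
  · exact hx0 ▸ zero_mem _
  have h0 : Submodule.span R {x} ≠ ⊥ := by simpa [Submodule.span_singleton_eq_bot] using hx0
  exact s.star_le_ft (Submodule.fg_span_singleton x) h0
    ((Submodule.span_singleton_le_iff_mem _ _).mpr hx)
    (s.le_star _ h0 (Submodule.mem_span_singleton_self x))

theorem SemistarOp.exists_le_star_of_fg_le_ft {E H : Submodule R F} (hE : E ≠ ⊥) (hH : H.FG)
    (hHE : H ≤ s.ft E) : ∃ G : Submodule R F, G.FG ∧ G ≠ ⊥ ∧ G ≤ E ∧ H ≤ s.star G := by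
  induction H, hH using Submodule.fg_induction with
  | singleton x =>
    obtain ⟨G, hG, h0, hGE, hx⟩ := (s.mem_ft hE).mp
      (hHE (Submodule.mem_span_singleton_self x))
    exact ⟨G, hG, h0, hGE, (Submodule.span_singleton_le_iff_mem _ _).mpr hx⟩
  | sup H₁ H₂ _ _ ih₁ ih₂ =>
    obtain ⟨G₁, hG₁, h0₁, hE₁, hH₁⟩ := ih₁ (le_sup_left.trans hHE)
    obtain ⟨G₂, hG₂, h0₂, hE₂, hH₂⟩ := ih₂ (le_sup_right.trans hHE)
    have h0 : G₁ ⊔ G₂ ≠ ⊥ := ne_bot_of_le_ne_bot h0₁ le_sup_left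
    exact ⟨G₁ ⊔ G₂, hG₁.sup hG₂, h0, sup_le hE₁ hE₂,
      sup_le (hH₁.trans (s.star_mono _ _ h0₁ h0 le_sup_left))
        (hH₂.trans (s.star_mono _ _ h0₂ h0 le_sup_right))⟩

theorem SemistarOp.ft_ft_le {E : Submodule R F} (hE : E ≠ ⊥) : s.ft (s.ft E) ≤ s.ft E := by
  refine iSup₂_le fun H ⟨hH, hH0, hHE⟩ => ?_
  obtain ⟨G, hG, hG0, hGE, hHG⟩ := s.exists_le_star_of_fg_le_ft hE hH hHE
  calc s.star H ≤ s.star (s.star G) :=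
        s.star_mono _ _ hH0 (ne_bot_of_le_ne_bot hG0 (s.le_star G hG0)) hHG
    _ = s.star G := s.star_idem G hG0
    _ ≤ s.ft E := s.star_le_ft hG hG0 hGE

theorem SemistarOp.smul_mem_ft {E E' : Submodule R F} (hE : E ≠ ⊥) {x y : F}
    (hx : ∀ z ∈ E, x * z ∈ E') (hy : y ∈ s.ft E) : x * y ∈ s.ft E' := by
  by_cases hx0 : x = 0
  · simp [hx0]
  obtain ⟨G, hG, hG0, hGE, hyG⟩ := (s.mem_ft hE).mp hy
  have hne : x • G ≠ ⊥ := by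
    obtain ⟨z, hz, hz0⟩ := Submodule.exists_mem_ne_zero_of_ne_bot hG0
    exact (Submodule.ne_bot_iff _).mpr
      ⟨x • z, Submodule.smul_mem_pointwise_smul z x G hz, mul_ne_zero hx0 hz0⟩
  have hle : x • G ≤ E' := by
    rintro _ ⟨z, hz, rfl⟩
    exact hx z (hGE hz)
  have hfg : (x • G).FG := hG.map _
  refine s.star_le_ft hfg hne hle ?_
  rw [s.star_smul x hx0 G hG0]
  exact Submodule.smul_mem_pointwise_smul y x _ hyG

section Ideals

theorem idealExt_mono {I J : Ideal R} (h : I ≤ J) :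
    (idealExt I : Submodule R F) ≤ idealExt J := Submodule.map_mono h

theorem algebraMap_mem_idealExt {I : Ideal R} {r : R} (hr : r ∈ I) :
    algebraMap R F r ∈ (idealExt I : Submodule R F) := ⟨r, hr, rfl⟩

theorem mem_idealCon {E : Submodule R F} {r : R} : r ∈ idealCon E ↔ algebraMap R F r ∈ E :=
  Iff.rfl

theorem idealExt_idealCon_le (E : Submodule R F) : idealExt (idealCon E) ≤ E :=
  Submodule.map_comap_le _ _

theorem one_mem_idealExt_top : (1 : F) ∈ (idealExt (⊤ : Ideal R) : Submodule R F) :=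
  ⟨1, trivial, by simp⟩

theorem idealExt_top_le_of_one_mem {E : Submodule R F} (h : (1 : F) ∈ E) :
    idealExt (⊤ : Ideal R) ≤ E := by
  rintro _ ⟨r, -, rfl⟩
  simpa [Algebra.smul_def] using E.smul_mem r h

theorem le_idealCon_ft (I : Ideal R) : I ≤ idealCon (s.ft (idealExt I)) :=
  fun _ hr => s.le_ft _ (algebraMap_mem_idealExt hr)

variable [FaithfulSMul R F]

theorem idealExt_ne_bot {I : Ideal R} (hI : I ≠ ⊥) : (idealExt I : Submodule R F) ≠ ⊥ := by
  obtain ⟨r, hr, hr0⟩ := Submodule.exists_mem_ne_zero_of_ne_bot hI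
  exact (Submodule.ne_bot_iff _).mpr ⟨_, algebraMap_mem_idealExt hr,
    (map_ne_zero_iff _ (FaithfulSMul.algebraMap_injective R F)).mpr hr0⟩

theorem one_notMem_ft_idealExt [Nontrivial R] {I : Ideal R} (hI : I ≠ ⊥)
    (h : s.ft (idealExt I) ≠ s.star (idealExt ⊤)) : (1 : F) ∉ s.ft (idealExt I) := by
  intro h1
  have hI' : (idealExt I : Submodule R F) ≠ ⊥ := idealExt_ne_bot hI
  have htop : (idealExt (⊤ : Ideal R) : Submodule R F) ≠ ⊥ := idealExt_ne_bot top_ne_bot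
  refine h (le_antisymm (iSup₂_le fun G hG => ?_) ?_)
  · exact s.star_mono _ _ hG.2.1 htop (hG.2.2.trans (idealExt_mono le_top))
  · obtain ⟨G, hG, hG0, hGI, h1G⟩ := (s.mem_ft hI').mp h1
    calc s.star (idealExt ⊤) ≤ s.star (s.star G) :=
          s.star_mono _ _ htop (ne_bot_of_le_ne_bot hG0 (s.le_star G hG0))
            (idealExt_top_le_of_one_mem h1G)
      _ = s.star G := s.star_idem G hG0
      _ ≤ _ := s.star_le_ft hG hG0 hGI

theorem ft_idealExt_ne_of_le [Nontrivial R] {I J : Ideal R} (hIJ : I ≤ J)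
    (h : s.ft (idealExt J) ≠ s.star (idealExt ⊤)) :
    s.ft (idealExt I) ≠ s.star (idealExt ⊤) := by
  intro hI
  refine h (le_antisymm (iSup₂_le fun G hG => ?_) (hI ▸ s.ft_mono (idealExt_mono hIJ)))
  exact s.star_mono _ _ hG.2.1 (idealExt_ne_bot top_ne_bot) (hG.2.2.trans (idealExt_mono le_top))

/-- A nonzero ideal `I` with `1 ∉ I^{⋆_f}` is contained in an ideal maximal with this property. -/
theorem exists_le_maximal_one_notMem_ft {I : Ideal R} (hI : I ≠ ⊥)
    (h1 : (1 : F) ∉ s.ft (idealExt I)) :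
    ∃ M : Ideal R, I ≤ M ∧ Maximal (fun J : Ideal R => (1 : F) ∉ s.ft (idealExt J)) M := by
  suffices H : ∃ M, I ≤ M ∧
      Maximal (· ∈ {J : Ideal R | I ≤ J ∧ (1 : F) ∉ s.ft (idealExt J)}) M by
    obtain ⟨M, hIM, hM⟩ := H
    exact ⟨M, hIM, hM.1.2, fun J hJ hMJ => hM.2 ⟨hIM.trans hMJ, hJ⟩ hMJ⟩
  refine zorn_le_nonempty₀ _ (fun c hc hchain y hy => ?_) I ⟨le_rfl, h1⟩
  refine ⟨sSup c, ⟨(hc hy).1.trans (le_sSup hy), fun h => ?_⟩, fun z hz => le_sSup hz⟩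
  have hne : sSup c ≠ ⊥ := ne_bot_of_le_ne_bot hI ((hc hy).1.trans (le_sSup hy))
  obtain ⟨G, hG, hG0, hGc, h1G⟩ := (s.mem_ft (idealExt_ne_bot hne)).mp h
  have hGJ : ∃ J ∈ c, G ≤ idealExt J := by
    clear hG0 h1G
    induction G, hG using Submodule.fg_induction with
    | singleton x =>
      obtain ⟨r, hr, hrx⟩ := hGc (Submodule.mem_span_singleton_self x)
      obtain ⟨J, hJ, hrJ⟩ := (Submodule.mem_sSup_of_directed ⟨y, hy⟩ hchain.directedOn).mp hr
      exact ⟨J, hJ, (Submodule.span_singleton_le_iff_mem _ _).mpr ⟨r, hrJ, hrx⟩⟩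
    | sup G₁ G₂ _ _ ih₁ ih₂ =>
      obtain ⟨J₁, hJ₁, h₁⟩ := ih₁ (le_sup_left.trans hGc)
      obtain ⟨J₂, hJ₂, h₂⟩ := ih₂ (le_sup_right.trans hGc)
      obtain ⟨J, hJ, h₁J, h₂J⟩ := hchain.directedOn J₁ hJ₁ J₂ hJ₂
      exact ⟨J, hJ, sup_le (h₁.trans (idealExt_mono h₁J)) (h₂.trans (idealExt_mono h₂J))⟩
  obtain ⟨J, hJ, hGJ⟩ := hGJ
  exact (hc hJ).2 (s.star_le_ft hG hG0 hGJ h1G)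

variable {s} in
theorem isQuasiMax_of_maximal {M : Ideal R} (h0 : M ≠ ⊥)
    (hM : Maximal (fun J : Ideal R => (1 : F) ∉ s.ft (idealExt J)) M) :
    IsQuasiMax s.ft M := by
  refine ⟨⟨h0, le_antisymm (hM.2 (fun h => hM.1 ?_) (le_idealCon_ft s M)) (le_idealCon_ft s M)⟩,
    ?_, fun J hJ hJtop hMJ => le_antisymm hMJ (hM.2 (fun h => hJtop ?_) hMJ)⟩
  · exact s.ft_ft_le (idealExt_ne_bot h0) (s.ft_mono (idealExt_idealCon_le _) h)
  · rintro rfl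
    exact hM.1 (s.le_ft _ one_mem_idealExt_top)
  · rw [Ideal.eq_top_iff_one, ← hJ.2, mem_idealCon, map_one]
    exact h

variable {s} in
theorem IsQuasiMax.isPrime_of_maximal {M : Ideal R} (h0 : M ≠ ⊥)
    (hM : Maximal (fun J : Ideal R => (1 : F) ∉ s.ft (idealExt J)) M) : M.IsPrime := by
  have hQ := isQuasiMax_of_maximal h0 hM
  refine ⟨hQ.2.1, fun {a b} hab => or_iff_not_imp_left.mpr fun ha => ?_⟩
  have h1 : (1 : F) ∈ s.ft (idealExt (M ⊔ Ideal.span {a})) := by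
    by_contra h
    exact ha (hM.2 h le_sup_left (Ideal.mem_sup_right (Ideal.mem_span_singleton_self a)))
  have hb : algebraMap R F b * 1 ∈ s.ft (idealExt M) := by
    refine s.smul_mem_ft (idealExt_ne_bot (ne_bot_of_le_ne_bot h0 le_sup_left)) ?_ h1
    rintro _ ⟨r, hr, rfl⟩
    obtain ⟨m, hm, t, ht, rfl⟩ := Submodule.mem_sup.mp hr
    obtain ⟨u, rfl⟩ := Ideal.mem_span_singleton'.mp ht
    refine ⟨b * (m + u * a), ?_, by simp⟩
    have : b * (m + u * a) = b * m + u * (a * b) := by ring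
    rw [this]
    exact M.add_mem (M.mul_mem_left _ hm) (M.mul_mem_left _ hab)
  rw [mul_one] at hb
  exact hQ.1.2 ▸ hb

/-- Contractions of nonzero ideals of `R_P`, for `P` inside a quasi-`⋆_f`-maximal prime, are
quasi-`⋆̃`-ideals. -/
theorem isQuasiIdeal_tilde_under {P M : Ideal R} [P.IsPrime] (hPM : P ≤ M) (hM : M.IsPrime)
    (hQ : IsQuasiMax s.ft M) {j : Ideal (Localization.AtPrime P)} (hj : j ≠ ⊥) :
    IsQuasiIdeal s.tilde (j.under R) := by
  refine ⟨fun h => hj ?_, le_antisymm (fun r hr => ?_) fun r hr => ?_⟩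
  · rw [← IsLocalization.map_under P.primeCompl (Localization.AtPrime P) j, h, Ideal.map_bot]
  · obtain ⟨d, hd, t, ht, hdt⟩ := hr M hQ hM
    have hdr : d * r = t := FaithfulSMul.algebraMap_injective R F <| by
      simpa [Algebra.smul_def] using hdt.symm
    have hmem : algebraMap R (Localization.AtPrime P) d * algebraMap R _ r ∈ j := by
      rw [← map_mul, hdr]
      exact ht
    exact (Ideal.unit_mul_mem_iff_mem _
      (IsLocalization.map_units (Localization.AtPrime P)
        (⟨d, fun h => hd (hPM h)⟩ : P.primeCompl))).mp hmem
  · intro N _ hN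
    exact ⟨1, hN.one_notMem, r, hr, by simp⟩

variable {s} in
theorem TildeNoetherian.isNoetherianRing_atPrime [Nontrivial R] (hN : TildeNoetherian s) {P : Ideal R}
    [P.IsPrime] (h0 : P ≠ ⊥) (hP : s.ft (idealExt P) ≠ s.star (idealExt ⊤)) :
    IsNoetherianRing (Localization.AtPrime P) := by
  obtain ⟨M, hPM, hM⟩ := exists_le_maximal_one_notMem_ft s h0 (one_notMem_ft_idealExt s h0 hP)
  have hM0 := ne_bot_of_le_ne_bot h0 hPM
  refine monotone_stabilizes_iff_noetherian.mp fun f => ?_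
  by_cases hf : ∀ k, f k = ⊥
  · exact ⟨0, fun m _ => by rw [hf, hf]⟩
  push Not at hf
  obtain ⟨k, hk⟩ := hf
  obtain ⟨N, hN⟩ := hN (fun i => Ideal.under R (f (i + k)))
    (fun i => isQuasiIdeal_tilde_under s hPM (IsQuasiMax.isPrime_of_maximal hM0 hM)
      (isQuasiMax_of_maximal hM0 hM) (ne_bot_of_le_ne_bot hk (f.mono (by omega))))
    fun a b hab => Ideal.comap_mono (f.mono (by omega))
  refine ⟨N + k, fun m hm => ?_⟩
  have h := hN (m - k) (by omega)
  simp only [Nat.sub_add_cancel (show k ≤ m by omega)] at h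
  rw [← IsLocalization.map_under P.primeCompl _ (f m), h,
    IsLocalization.map_under P.primeCompl _ (f (N + k))]

end Ideals

end Semistar

theorem isNoetherianRing_atPrime_of_eq_bot {R : Type*} [CommRing R] [IsDomain R] {P : Ideal R}
    [P.IsPrime] (hP : P = ⊥) : IsNoetherianRing (Localization.AtPrime P) := by
  subst hP
  have h : IsLocalization (nonZeroDivisors R) (Localization.AtPrime (⊥ : Ideal R)) := by
    simpa [Ideal.primeCompl_bot] using
      Localization.isLocalization (M := (⊥ : Ideal R).primeCompl)
  have : IsFractionRing R (Localization.AtPrime (⊥ : Ideal R)) := h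
  let e := (FractionRing.algEquiv R (Localization.AtPrime (⊥ : Ideal R))).toRingEquiv
  exact isNoetherianRing_of_ringEquiv _ e

/-- Primes of `R[X₁,…,Xₙ]` below a quasi-`⋆[n]`-prime are again quasi-`⋆[n]`-primes. -/
theorem QuasiPolyPrime.of_le {R F : Type*} [CommRing R] [Nontrivial R] [Field F] [Algebra R F]
    [FaithfulSMul R F] {s : SemistarOp R F} {n : ℕ} {I Q : Ideal (MvPolynomial (Fin n) R)}
    (hQ : QuasiPolyPrime s n Q) (hI : I.IsPrime) (h0 : I ≠ ⊥) (hIQ : I ≤ Q) :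
    QuasiPolyPrime s n I := by
  refine ⟨h0, hI, hQ.2.2.imp (fun h => ?_) fun h => ?_⟩
  · exact le_bot_iff.mp (h ▸ Ideal.comap_mono hIQ)
  · exact ft_idealExt_ne_of_le s (Ideal.comap_mono hIQ) h

/-- Every `⋆̃`-Noetherian domain is a `⋆̃`-stably strong S-domain. -/
theorem tildeNoetherian_isTildeStablyStrongS (D : Type*) [CommRing D] [IsDomain D]
    (s : SemistarOp D (FractionRing D)) (hN : TildeNoetherian s) :
    TildeStablyStrongSDomain s := by
  intro n _ Q₁ Q₂ hQ₁ hQ₂ hadj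
  set f := (MvPolynomial.rename (Fin.castSucc : Fin n → Fin (n + 1)) :
    MvPolynomial (Fin n) D →ₐ[D] _).toRingHom with hf
  have hcm : ∀ Q : Ideal (MvPolynomial (Fin n) D), (Q.map f).comap f = Q :=
    MvPolynomial.comap_map_rename_castSucc
  have hcc := fun I => MvPolynomial.comap_algebraMap_comap_rename_castSucc (R := D) (n := n) I
  have hext : ∀ Q : Ideal (MvPolynomial (Fin n) D), QuasiPolyPrime s n Q →
      QuasiPolyPrime s (n + 1) (Q.map f) := fun Q hQ => by
    refine ⟨fun h => hQ.1 ?_, MvPolynomial.isPrime_map_rename_castSucc hQ.2.1, ?_⟩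
    · exact (Ideal.map_eq_bot_iff_of_injective
        (MvPolynomial.rename_injective _ (Fin.castSucc_injective n))).mp h
    · rw [← hcc (Q.map f), hcm Q]
      exact hQ.2.2
  refine ⟨hext Q₁ hQ₁, hext Q₂ hQ₂, lt_of_le_of_ne (Ideal.map_mono hadj.1.le) fun h => ?_, ?_⟩
  · exact hadj.1.ne (by rw [← hcm Q₁, h, hcm Q₂])
  rintro I hI ⟨hlt, hgt⟩
  obtain ⟨a, ha₂, ha₁⟩ := SetLike.exists_of_lt hadj.1
  set P : Ideal D := Q₂.comap (algebraMap D (MvPolynomial (Fin n) D)) with hP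
  have hPprime : P.IsPrime := hQ₂.2.1.comap _
  have hnoeth : IsNoetherianRing (Localization.AtPrime P) := by
    by_cases h0 : P = ⊥
    · exact isNoetherianRing_atPrime_of_eq_bot h0
    · exact hN.isNoetherianRing_atPrime h0 (hQ₂.2.2.resolve_left h0)
  let : Algebra (MvPolynomial (Fin (n + 1)) D)
      (MvPolynomial (Fin (n + 1)) (Localization.AtPrime P)) := MvPolynomial.algebraMvPolynomial
  refine Ideal.not_lt_lt_of_isLocalization (B := MvPolynomial (Fin (n + 1)) (Localization.AtPrime P))
    (P.primeCompl.map (MvPolynomial.C (σ := Fin (n + 1)))) (x := f a)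
    (hext Q₁ hQ₁).2.1 hI.2.1 (hext Q₂ hQ₂).2.1 ?_ (Ideal.mem_map_of_mem f ha₂) ?_ hlt hgt
  · rw [Set.disjoint_left]
    rintro _ ⟨d, hd, rfl⟩ hdQ
    refine hd ?_
    rw [hP, ← hcm Q₂, hcc]
    exact hdQ
  · intro j hj hQ₁j haj hjQ₂
    have hle₁ : Q₁ ≤ j.comap f := Ideal.map_le_iff_le_comap.mp hQ₁j
    have hlt₁ : Q₁ < j.comap f := lt_of_le_of_ne hle₁ fun h => ha₁ (by rw [h]; exact haj)
    have hle₂ : j.comap f ≤ Q₂ := hcm Q₂ ▸ Ideal.comap_mono hjQ₂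
    have hquasi : QuasiPolyPrime s n (j.comap f) :=
      hQ₂.of_le (hj.comap f) (ne_bot_of_gt hlt₁) hle₂
    have heq : j.comap f = Q₂ := by
      by_contra h
      exact hadj.2 _ hquasi ⟨hlt₁, lt_of_le_of_ne hle₂ h⟩
    exact le_antisymm hjQ₂ (Ideal.map_le_iff_le_comap.mpr heq.ge)
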